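/- arXiv:2603.00891 — 5 statements merged into one kernel-verified Lean document; each statement's English description precedes it below -/
import Mathlib

section
/- Let H be a real Hilbert space and let x, y, z ∈ H. Set χ = ⟪x − y, y − z⟫, μ = ‖x − y‖², ν = ‖y − z‖², and ρ = μν − χ². Then the point Q(x,y,z), defined as the metric projection of x onto O(x,y,z), is given by: Q(x,y,z) = y if ρ = 0 and χ < 0; Q(x,y,z) = z if ρ = 0 and χ ≥ 0; Q(x,y,z) = x + (1 + χ/ν)(z − y) if ρ > 0 and χν ≥ ρ; and Q(x,y,z) = y + (ν/ρ)(χ(x − y) + μ(z − y)) if ρ > 0 and χν < ρ. -/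
open MeasureTheory Filter RealInnerProductSpace

/-- The half-space `H(x,y) = {z : ⟪z - y, x - y⟫ ≤ 0}`. -/
def halfSpace {H : Type*} [NormedAddCommGroup H] [InnerProductSpace ℝ H] (x y : H) : Set H :=
  {z : H | ⟪z - y, x - y⟫ ≤ 0}

open scoped Classical in
/-- The outer set `O(x,y,z)`. -/
noncomputable def Oset {H : Type*} [NormedAddCommGroup H] [InnerProductSpace ℝ H]
    (x y z : H) : Set H :=
  if (halfSpace x y ∩ halfSpace y z).Nonempty then halfSpace x y ∩ halfSpace y z else {y}

/-- `q` is the metric projection of `x` onto `C`. -/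
def IsProjPt {H : Type*} [NormedAddCommGroup H] [InnerProductSpace ℝ H]
    (C : Set H) (x q : H) : Prop :=
  q ∈ C ∧ ∀ w ∈ C, ‖x - q‖ ≤ ‖x - w‖

theorem kkt_aux {H : Type*} [NormedAddCommGroup H] [InnerProductSpace ℝ H]
    (x y z q p : H) (hq : IsProjPt (Oset x y z) x q) (s t : ℝ) (hs : 0 ≤ s) (ht : 0 ≤ t)
    (hx : x - p = s • (x - y) + t • (y - z))
    (h1 : ⟪p - y, x - y⟫ ≤ 0) (h2 : ⟪p - z, y - z⟫ ≤ 0)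
    (e1 : s * ⟪p - y, x - y⟫ = 0) (e2 : t * ⟪p - z, y - z⟫ = 0) : q = p := by
  have hne : (halfSpace x y ∩ halfSpace y z).Nonempty := ⟨p, h1, h2⟩
  have hO : Oset x y z = halfSpace x y ∩ halfSpace y z := if_pos hne
  rw [hO] at hq
  obtain ⟨⟨q1, q2⟩, hmin⟩ := hq
  have hle := hmin p ⟨h1, h2⟩
  have q1' : ⟪q - y, x - y⟫ ≤ 0 := q1
  have q2' : ⟪q - z, y - z⟫ ≤ 0 := q2
  have e3 : ⟪x - p, p - q⟫ = s * (⟪p - y, x - y⟫ - ⟪q - y, x - y⟫)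
      + t * (⟪p - z, y - z⟫ - ⟪q - z, y - z⟫) := by
    rw [hx, inner_add_left, real_inner_smul_left, real_inner_smul_left, ← inner_sub_left,
      ← inner_sub_left, real_inner_comm, real_inner_comm (p - q) (y - z)]
    simp
  have e4 : ‖x - q‖ ^ 2 = ‖x - p‖ ^ 2 + 2 * ⟪x - p, p - q⟫ + ‖p - q‖ ^ 2 := by
    rw [← norm_add_sq_real]; simp
  have e5 : 0 ≤ ⟪x - p, p - q⟫ := by
    rw [e3]; nlinarith [mul_nonneg hs (neg_nonneg.2 q1'), mul_nonneg ht (neg_nonneg.2 q2')]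
  have e6 : ‖x - q‖ ^ 2 ≤ ‖x - p‖ ^ 2 := by gcongr
  have e7 : ‖p - q‖ = 0 := by
    have : ‖p - q‖ ^ 2 ≤ 0 := by linarith
    exact pow_eq_zero_iff (two_ne_zero) |>.1 (le_antisymm this (sq_nonneg _))
  exact (sub_eq_zero.1 (norm_eq_zero.1 e7)).symm

/-- Explicit formula for `Q(x,y,z) = proj_{O(x,y,z)} x`. -/
theorem explicit_formula_for_Q {H : Type*} [NormedAddCommGroup H] [InnerProductSpace ℝ H]
    (x y z q : H) (χ m ν ρ : ℝ)
    (hχ : χ = ⟪x - y, y - z⟫) (hm : m = ‖x - y‖ ^ 2) (hν : ν = ‖y - z‖ ^ 2)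
    (hρ : ρ = m * ν - χ ^ 2)
    (hq : IsProjPt (Oset x y z) x q) :
    (ρ = 0 → χ < 0 → q = y) ∧
    (ρ = 0 → 0 ≤ χ → q = z) ∧
    (0 < ρ → ρ ≤ χ * ν → q = x + (1 + χ / ν) • (z - y)) ∧
    (0 < ρ → χ * ν < ρ → q = y + (ν / ρ) • (χ • (x - y) + m • (z - y))) := by
  have hχ' : ⟪y - z, x - y⟫ = χ := by rw [hχ, real_inner_comm]
  have hm' : ⟪x - y, x - y⟫ = m := by rw [hm, real_inner_self_eq_norm_sq]
  have hν' : ⟪y - z, y - z⟫ = ν := by rw [hν, real_inner_self_eq_norm_sq]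
  have hν0 : 0 ≤ ν := by rw [hν]; positivity
  have hm0 : 0 ≤ m := by rw [hm]; positivity
  have hpar : ρ = 0 → ν • (x - y) = χ • (y - z) := by
    intro h0
    rw [← sub_eq_zero, ← inner_self_eq_zero (𝕜 := ℝ)]
    simp only [inner_sub_left (ν • (x - y)), inner_sub_right _ (ν • (x - y)),
      real_inner_smul_left, real_inner_smul_right, hχ', hm', hν', ← hχ]
    linear_combination ν * h0 - ν * hρ
  have hneg : z - y = -(y - z) := by abel
  refine ⟨fun h0 hc => ?_, fun h0 hc => ?_, fun h0 hc => ?_, fun h0 hc => ?_⟩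
  · have hemp : ¬ (halfSpace x y ∩ halfSpace y z).Nonempty := by
      rintro ⟨w, w1, w2⟩
      have w1' : ⟪w - y, x - y⟫ ≤ 0 := w1
      have w2' : ⟪w - z, y - z⟫ ≤ 0 := w2
      have e : w - z = (w - y) + (y - z) := by abel
      rw [e, inner_add_left, hν'] at w2'
      have e2 : ν * ⟪w - y, x - y⟫ = χ * ⟪w - y, y - z⟫ := by
        rw [← real_inner_smul_right, ← real_inner_smul_right, hpar h0]
      have hνp : 0 < ν := by
        rcases hν0.eq_or_lt with h | h
        · nlinarith
        · exact h
      nlinarith [mul_nonneg hνp.le (neg_nonneg.2 w1'), mul_pos_of_neg_of_neg hc (show ⟪w - y, y - z⟫ < 0 by linarith)]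
    have hq1 := hq.1
    rw [show Oset x y z = {y} from if_neg hemp] at hq1
    exact hq1
  · rcases hν0.eq_or_lt with h | h
    · have hb : y - z = 0 := by
        rw [← inner_self_eq_zero (𝕜 := ℝ), hν', h]
      refine kkt_aux x y z q z hq 1 1 (by norm_num) (by norm_num) (by simp) ?_ ?_ ?_ ?_ <;>
        simp [hneg, hb]
    · have ha : x - y = (χ / ν) • (y - z) := by
        rw [div_eq_inv_mul, mul_smul, ← hpar h0, smul_smul, inv_mul_cancel₀ h.ne', one_smul]
      refine kkt_aux x y z q z hq 0 (1 + χ / ν) le_rfl (by positivity) ?_ ?_ ?_ ?_ ?_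
      · rw [zero_smul, zero_add, add_smul, one_smul, ← ha]; abel
      · rw [hneg, inner_neg_left, hχ']; linarith
      · simp
      · simp
      · simp
  · have hνp : 0 < ν := by
      rcases hν0.eq_or_lt with h | h
      · rw [← h] at hc; linarith
      · exact h
    have hcp : 0 < χ := by
      by_contra hcon
      nlinarith [mul_nonneg hνp.le (neg_nonneg.2 (not_lt.1 hcon))]
    have p1 : x + (1 + χ / ν) • (z - y) - y = (x - y) - (1 + χ / ν) • (y - z) := by module
    have p2 : x + (1 + χ / ν) • (z - y) - z = (x - y) - (χ / ν) • (y - z) := by module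
    have i2 : ⟪x + (1 + χ / ν) • (z - y) - z, y - z⟫ = 0 := by
      rw [p2, inner_sub_left, real_inner_smul_left, hν', ← hχ]; field_simp; ring
    refine kkt_aux x y z q _ hq 0 (1 + χ / ν) le_rfl (by positivity) (by module) ?_ i2.le
      (by simp) (by rw [i2, mul_zero])
    rw [p1, inner_sub_left, real_inner_smul_left, hχ', hm']
    have : m - (1 + χ / ν) * χ = (ρ - χ * ν) / ν := by rw [hρ]; field_simp; ring
    rw [this]
    exact div_nonpos_of_nonpos_of_nonneg (by linarith) hν0
  · have p1 : y + (ν / ρ) • (χ • (x - y) + m • (z - y)) - y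
        = (ν / ρ * χ) • (x - y) - (ν / ρ * m) • (y - z) := by module
    have p2 : y + (ν / ρ) • (χ • (x - y) + m • (z - y)) - z
        = (ν / ρ * χ) • (x - y) + (1 - ν / ρ * m) • (y - z) := by module
    have i1 : ⟪y + (ν / ρ) • (χ • (x - y) + m • (z - y)) - y, x - y⟫ = 0 := by
      rw [p1, inner_sub_left, real_inner_smul_left, real_inner_smul_left, hχ', hm']; ring
    have i2 : ⟪y + (ν / ρ) • (χ • (x - y) + m • (z - y)) - z, y - z⟫ = 0 := by
      rw [p2, inner_add_left, real_inner_smul_left, real_inner_smul_left, hν', ← hχ]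
      field_simp
      linear_combination ν * hρ
    refine kkt_aux x y z q _ hq (1 - ν / ρ * χ) (ν / ρ * m) ?_ (by positivity) (by module)
      i1.le i2.le (by rw [i1, mul_zero]) (by rw [i2, mul_zero])
    have : 1 - ν / ρ * χ = (ρ - χ * ν) / ρ := by field_simp
    rw [this]
    exact div_nonneg (by linarith) h0.le
end

section
/- Let Z₁,…,Z_p be finitely many closed convex subsets of H whose intersection Z = ∩_{k=1}^p Z_k is nonempty, and let x₀ ∈ H. Let k be a random variable with values in {1,…,p} such that P([k = j]) > 0 for every j ∈ {1,…,p}. Generate (x_n) by: x_0 = x₀ and, for every n ∈ ℕ, k_n is a copy of k (identically distributed with k) independent of σ(x₀,…,x_n), and x_{n+1}(ω) = Q(x₀, x_n(ω), proj_{Z_{k_n(ω)}} x_n(ω)) for every ω. Then (x_n) converges strongly P-a.s. and strongly in L²(Ω,ℱ,P;H) to proj_Z x₀. -/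
open MeasureTheory Filter RealInnerProductSpace Topology

section HaugazeauHelpers

variable {H : Type*} [NormedAddCommGroup H] [InnerProductSpace ℝ H]

lemma IsProjPt.inner_le {C : Set H} (hC : Convex ℝ C) {x q : H} (h : IsProjPt C x q) :
    ∀ w ∈ C, ⟪x - q, w - q⟫ ≤ 0 := by
  have key := norm_eq_iInf_iff_real_inner_le_zero hC (u := x) h.1
  apply key.1
  have : Nonempty C := ⟨⟨q, h.1⟩⟩
  apply le_antisymm
  · exact le_ciInf fun w => h.2 w w.2
  · exact ciInf_le (f := fun w : C => ‖x - w‖) ⟨0, by rintro _ ⟨w, rfl⟩; positivity⟩ ⟨q, h.1⟩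

lemma proj_lipschitz {C : Set H} (hC : Convex ℝ C) {P : H → H} (h : ∀ v, IsProjPt C v (P v)) :
    Continuous P := by
  have : LipschitzWith 1 P := by
    apply LipschitzWith.of_dist_le_mul
    intro u v
    rw [dist_eq_norm, dist_eq_norm]
    have h1 := (h u).inner_le hC _ (h v).1
    have h2 := (h v).inner_le hC _ (h u).1
    have h3 : ‖P u - P v‖ ^ 2 ≤ ⟪u - v, P u - P v⟫ := by
      rw [← real_inner_self_eq_norm_sq]
      have : ⟪u - v, P u - P v⟫ - ⟪P u - P v, P u - P v⟫
        = - ⟪u - P u, P v - P u⟫ - ⟪v - P v, P u - P v⟫ := by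
        simp only [inner_sub_left, inner_sub_right]; ring
      linarith
    have h4 := real_inner_le_norm (u - v) (P u - P v)
    simp only [NNReal.coe_one, one_mul]
    by_contra hlt
    push Not at hlt
    nlinarith [norm_nonneg (u - v), norm_nonneg (P u - P v)]
  exact this.continuous

lemma convex_halfSpace' (x y : H) : Convex ℝ (halfSpace x y) := by
  intro u hu v hv a b ha hb hab
  simp only [halfSpace, Set.mem_ofPred_eq] at *
  have : a • u + b • v - y = a • (u - y) + b • (v - y) := by
    have : y = (a + b) • y := by rw [hab, one_smul]
    nth_rewrite 1 [this]
    module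
  rw [this, inner_add_left, real_inner_smul_left, real_inner_smul_left]
  nlinarith

/-- explicit Haugazeau formula -/
noncomputable def haugQ (x y z : H) : H :=
  if ‖y - z‖ ^ 2 = 0 then y else
  if ‖x - y‖ ^ 2 * ‖y - z‖ ^ 2 - ⟪x - y, y - z⟫ ^ 2 ≤ ⟪x - y, y - z⟫ * ‖y - z‖ ^ 2 then
    x - (1 + ⟪x - y, y - z⟫ / ‖y - z‖ ^ 2) • (y - z)
  else y + (‖y - z‖ ^ 2 / (‖x - y‖ ^ 2 * ‖y - z‖ ^ 2 - ⟪x - y, y - z⟫ ^ 2)) •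
    (⟪x - y, y - z⟫ • (x - y) - ‖x - y‖ ^ 2 • (y - z))

lemma kkt {x y z g : H} {α β : ℝ} (hα : 0 ≤ α) (hβ : 0 ≤ β)
    (h1 : ⟪g - y, x - y⟫ ≤ 0) (h2 : ⟪g - z, y - z⟫ ≤ 0)
    (s1 : α * ⟪g - y, x - y⟫ = 0) (s2 : β * ⟪g - z, y - z⟫ = 0)
    (he : x - g = α • (x - y) + β • (y - z)) {q : H}
    (hq : IsProjPt (halfSpace x y ∩ halfSpace y z) x q) : q = g := by
  have hqg := hq.2 g ⟨h1, h2⟩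
  obtain ⟨q1, q2⟩ := hq.1
  simp only [halfSpace, Set.mem_ofPred_eq] at q1 q2
  have e : ⟪x - g, q - g⟫ = α * (⟪q - y, x - y⟫ - ⟪g - y, x - y⟫)
      + β * (⟪q - z, y - z⟫ - ⟪g - z, y - z⟫) := by
    rw [he, inner_add_left, real_inner_smul_left, real_inner_smul_left, ← inner_sub_left,
      ← inner_sub_left, real_inner_comm, real_inner_comm (q - g), sub_sub_sub_cancel_right,
      sub_sub_sub_cancel_right]
  have e2 : ⟪x - g, q - g⟫ ≤ 0 := by
    rw [e]; nlinarith [mul_nonneg hα (neg_nonneg.2 q1), mul_nonneg hβ (neg_nonneg.2 q2)]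
  have e3 : ‖x - q‖ ^ 2 = ‖x - g‖ ^ 2 - 2 * ⟪x - g, q - g⟫ + ‖q - g‖ ^ 2 := by
    rw [← norm_sub_sq_real]; congr 2; abel
  have e4 : ‖q - g‖ ^ 2 ≤ 0 := by nlinarith [norm_nonneg (x - q), norm_nonneg (x - g)]
  have : ‖q - g‖ = 0 := by nlinarith [norm_nonneg (q - g)]
  exact sub_eq_zero.1 (norm_eq_zero.1 this)

lemma haugQ_eq {x y z q : H} (hq : IsProjPt (halfSpace x y ∩ halfSpace y z) x q) :
    q = haugQ x y z := by
  have hb := real_inner_self_eq_norm_sq (y - z)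
  have ha := real_inner_self_eq_norm_sq (x - y)
  have hab := real_inner_comm (x - y) (y - z)
  have hcs : ⟪x - y, y - z⟫ ^ 2 ≤ ‖x - y‖ ^ 2 * ‖y - z‖ ^ 2 := by
    rw [← mul_pow, sq_le_sq, abs_of_nonneg (a := ‖x - y‖ * ‖y - z‖) (by positivity)]
    exact abs_real_inner_le_norm _ _
  unfold haugQ
  split_ifs with h0 h1
  · have hz : y - z = 0 := by simpa using h0
    apply kkt (α := 1) (β := 0) (x := x) (y := y) (z := z) (q := q) <;> simp [hz, hq]
  · have hν : 0 < ‖y - z‖ ^ 2 := lt_of_le_of_ne (by positivity) (Ne.symm h0)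
    set a := x - y with ha'
    set b := y - z with hb'
    set ν := ‖b‖ ^ 2
    set m := ‖a‖ ^ 2
    set π := ⟪a, b⟫
    have hπ : 0 ≤ π := by
      by_contra hh
      push Not at hh
      nlinarith
    have i1 : ⟪x - (1 + π / ν) • b - y, a⟫ = (m * ν - π ^ 2 - π * ν) / ν := by
      have : x - (1 + π / ν) • b - y = a - (1 + π / ν) • b := by rw [ha']; abel
      rw [this, inner_sub_left, real_inner_smul_left, ha, hab]
      field_simp
      ring
    have i2 : ⟪x - (1 + π / ν) • b - z, b⟫ = 0 := by
      have : x - (1 + π / ν) • b - z = a + b - (1 + π / ν) • b := by rw [ha', hb']; abel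
      rw [this, inner_sub_left, inner_add_left, real_inner_smul_left, hb]
      change π + ν - (1 + π / ν) * ν = 0
      field_simp
      ring
    apply kkt (α := 0) (β := 1 + π / ν) (x := x) (y := y) (z := z) (q := q) le_rfl
      (by positivity) _ _ _ _ _ hq
    · rw [← ha', i1]; exact div_nonpos_of_nonpos_of_nonneg (by linarith) hν.le
    · rw [← hb', i2]
    · simp
    · rw [← hb', i2]; simp
    · rw [← hb']; simp
  · have hν : 0 < ‖y - z‖ ^ 2 := lt_of_le_of_ne (by positivity) (Ne.symm h0)
    obtain ⟨q1, q2⟩ := hq.1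
    simp only [halfSpace, Set.mem_ofPred_eq] at q1 q2
    set a := x - y with ha'
    set b := y - z with hb'
    have q3 : q - z = (q - y) + b := by rw [hb']; abel
    rw [q3, inner_add_left, hb] at q2
    set ν := ‖b‖ ^ 2
    set m := ‖a‖ ^ 2
    set π := ⟪a, b⟫
    push Not at h1
    have hρ : 0 < m * ν - π ^ 2 := by
      by_contra hh
      have hr : m * ν - π ^ 2 = 0 := by linarith
      have hpar : ν • a - π • b = 0 := by
        rw [← inner_self_eq_zero (𝕜 := ℝ)]
        simp only [inner_sub_left, inner_sub_right, real_inner_smul_left, real_inner_smul_right,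
          ha, hb, hab]
        linear_combination ν * hr
      have h5 : ν * ⟪q - y, a⟫ = π * ⟪q - y, b⟫ := by
        rw [← real_inner_smul_right, ← real_inner_smul_right, sub_eq_zero.1 hpar]
      have hπ : π < 0 := by
        by_contra h7
        push Not at h7
        nlinarith
      nlinarith [mul_pos hν hν]
    set ρ := m * ν - π ^ 2 with hρ'
    have i1 : ⟪y + (ν / ρ) • (π • a - m • b) - y, a⟫ = 0 := by
      rw [add_sub_cancel_left, real_inner_smul_left, inner_sub_left, real_inner_smul_left,
        real_inner_smul_left, ha, hab]
      change ν / ρ * (π * m - m * π) = 0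
      ring
    have i2 : ⟪y + (ν / ρ) • (π • a - m • b) - z, b⟫ = 0 := by
      have : y + (ν / ρ) • (π • a - m • b) - z = (ν / ρ) • (π • a - m • b) + b := by
        rw [hb']; abel
      rw [this, inner_add_left, real_inner_smul_left, inner_sub_left, real_inner_smul_left,
        real_inner_smul_left, hb]
      change ν / ρ * (π * π - m * ν) + ν = 0
      field_simp
      rw [hρ']
      ring
    have hm : 0 ≤ m := by positivity
    apply kkt (α := 1 - ν * π / ρ) (β := ν * m / ρ) (x := x) (y := y) (z := z) (q := q) _
      (by positivity) _ _ _ _ _ hq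
    · rw [sub_nonneg, div_le_one hρ]; linarith
    · rw [← ha', i1]
    · rw [← hb', i2]
    · rw [← ha', i1]; simp
    · rw [← hb', i2]; simp
    · rw [← ha', ← hb']
      have : x - (y + (ν / ρ) • (π • a - m • b)) = a - (ν / ρ) • (π • a - m • b) := by
        rw [ha']; abel
      rw [this]
      module

lemma measurable_haugQ [SecondCountableTopology H] [MeasurableSpace H] [BorelSpace H]
    {Ω : Type*} [MeasurableSpace Ω] (x : H) {y z : Ω → H} (hy : Measurable y)
    (hz : Measurable z) : Measurable fun ω => haugQ x (y ω) (z ω) := by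
  unfold haugQ
  have m1 : Measurable fun ω => ‖y ω - z ω‖ ^ 2 := by fun_prop
  have m2 : Measurable fun ω => ‖x - y ω‖ ^ 2 := by fun_prop
  have m3 : Measurable fun ω => ⟪x - y ω, y ω - z ω⟫ := by fun_prop
  refine Measurable.ite (m1 (measurableSet_singleton 0)) hy (Measurable.ite ?_ ?_ ?_)
  · exact measurableSet_le (by fun_prop) (by fun_prop)
  · fun_prop
  · fun_prop

/-- Deterministic convergence. -/
lemma det_conv [CompleteSpace H] {p : ℕ} {Z : Fin p → Set H} (hZconv : ∀ j, Convex ℝ (Z j))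
    {P : Fin p → H → H} (hP : ∀ j v, IsProjPt (Z j) v (P j v)) {x0 q : H}
    (hq : IsProjPt (⋂ j, Z j) x0 q) (x : ℕ → H) (hb : ∀ n, ‖x n - x0‖ ≤ ‖q - x0‖)
    (hd : ∀ j, Tendsto (fun n => ‖x n - P j (x n)‖) atTop (𝓝 0)) :
    Tendsto x atTop (𝓝 q) := by
  rw [tendsto_iff_ultrafilter]
  intro U hU
  have hU' : (U : Filter ℕ) ≤ atTop := hU
  -- weak limit
  obtain ⟨w, hw⟩ : ∃ w : H, ∀ v, Tendsto (fun n => ⟪x n, v⟫) U (𝓝 ⟪w, v⟫) := by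
    let F : ℕ → WeakDual ℝ H := fun n =>
      StrongDual.toWeakDual (InnerProductSpace.toDual ℝ H (x n))
    have hc := WeakDual.isCompact_closedBall (𝕜 := ℝ) (E := H) 0 (‖q - x0‖ + ‖x0‖)
    obtain ⟨f, -, hf⟩ := hc.ultrafilter_le_nhds (U.map F) (by
      simp only [le_principal_iff]
      refine Filter.mem_map.2 (Filter.univ_mem' fun n => ?_)
      have : ‖x n‖ ≤ ‖q - x0‖ + ‖x0‖ := by
        have := norm_add_le (x n - x0) x0
        rw [sub_add_cancel] at this
        linarith [hb n]
      simpa [F] using this)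
    refine ⟨(InnerProductSpace.toDual ℝ H).symm (WeakDual.toStrongDual f), fun v => ?_⟩
    rw [InnerProductSpace.toDual_symm_apply]
    have h1 : Tendsto F U (𝓝 f) := hf
    exact ((WeakDual.eval_continuous v).tendsto f).comp h1
  have hwZ : w ∈ ⋂ j, Z j := by
    rw [Set.mem_iInter]
    intro j
    have h1 : Tendsto (fun n => ⟪x n, w - P j w⟫ - ⟪P j w, w - P j w⟫
        - ‖x n - P j (x n)‖ * ‖w - P j w‖) U
        (𝓝 (⟪w, w - P j w⟫ - ⟪P j w, w - P j w⟫ - 0 * ‖w - P j w‖)) :=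
      ((hw _).sub_const _).sub (((hd j).mono_left hU').mul_const _)
    have h2 := le_of_tendsto' h1 (b := 0) (fun n => by
      have a1 := (hP j w).inner_le (hZconv j) _ (hP j (x n)).1
      have a2 := real_inner_le_norm (x n - P j (x n)) (w - P j w)
      rw [real_inner_comm] at a1
      simp only [inner_sub_left] at a1 a2 ⊢
      linarith)
    rw [zero_mul, sub_zero, ← inner_sub_left, real_inner_self_eq_norm_sq] at h2
    have : ‖w - P j w‖ = 0 := by nlinarith [norm_nonneg (w - P j w)]
    rw [sub_eq_zero.1 (norm_eq_zero.1 this)]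
    exact (hP j w).1
  have hvi := hq.inner_le (convex_iInter hZconv) w hwZ
  have h3 : Tendsto (fun n => 2 * (⟪q, q - x0⟫ - ⟪x n, q - x0⟫)) U
      (𝓝 (2 * (⟪q, q - x0⟫ - ⟪w, q - x0⟫))) := ((hw _).const_sub _).const_mul _
  have hle : ∀ n, ‖x n - q‖ ^ 2 ≤ 2 * (⟪q, q - x0⟫ - ⟪x n, q - x0⟫) := fun n => by
    have e : x n - q = (x n - x0) - (q - x0) := by abel
    have e3 : ‖x n - x0‖ ^ 2 ≤ ‖q - x0‖ ^ 2 := by gcongr; exact hb n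
    have e2 := real_inner_self_eq_norm_sq (q - x0)
    rw [e, norm_sub_sq_real]
    simp only [inner_sub_left] at e2 ⊢
    linarith
  have h0 : 2 * (⟪q, q - x0⟫ - ⟪w, q - x0⟫) = 0 := by
    apply le_antisymm
    · have : ⟪x0 - q, w - q⟫ = ⟪q, q - x0⟫ - ⟪w, q - x0⟫ := by
        rw [← inner_sub_left, real_inner_comm, ← inner_neg_neg]; simp
      linarith
    · exact ge_of_tendsto' h3 fun n => (sq_nonneg _).trans (hle n)
  rw [h0] at h3
  have h4 : Tendsto (fun n => ‖x n - q‖ ^ 2) U (𝓝 0) :=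
    squeeze_zero (fun n => sq_nonneg _) hle h3
  have h5 : Tendsto (fun n => ‖x n - q‖) U (𝓝 0) := by
    have := h4.sqrt
    simpa using this
  exact tendsto_iff_norm_sub_tendsto_zero.2 h5

end HaugazeauHelpers

/-- Corollary 4.6: the randomized Haugazeau method for the best approximation from a finite
intersection of closed convex sets converges strongly a.s. and strongly in `L²` to
`proj_Z x₀`. -/
theorem random_haugazeau_finite_intersection
    {Ω : Type*} [MeasurableSpace Ω] (μ : Measure Ω)
    [IsProbabilityMeasure μ] [μ.IsComplete]
    {H : Type*} [NormedAddCommGroup H] [InnerProductSpace ℝ H] [CompleteSpace H]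
    [SecondCountableTopology H] [MeasurableSpace H] [BorelSpace H]
    (p : ℕ) (hp : 1 ≤ p)
    (Z : Fin p → Set H) (hZcl : ∀ j, IsClosed (Z j)) (hZconv : ∀ j, Convex ℝ (Z j))
    (hZne : (⋂ j, Z j).Nonempty)
    (x0 : H)
    (k : Ω → Fin p) (hk : Measurable k) (hkpos : ∀ j, 0 < μ (k ⁻¹' {j}))
    (proj : Fin p → H → H) (hproj : ∀ j v, IsProjPt (Z j) v (proj j v))
    (x : ℕ → Ω → H) (hxinit : ∀ ω, x 0 ω = x0)
    (ks : ℕ → Ω → Fin p) (hksmeas : ∀ n, Measurable (ks n))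
    (hkscopy : ∀ n j, μ (ks n ⁻¹' {j}) = μ (k ⁻¹' {j}))
    (hksindep : ∀ n, ProbabilityTheory.Indep
      (MeasurableSpace.comap (ks n) inferInstance)
      (⨆ i : Fin (n + 1), MeasurableSpace.comap (x i) inferInstance) μ)
    (hxsucc : ∀ n ω,
      IsProjPt (Oset x0 (x n ω) (proj (ks n ω) (x n ω))) x0 (x (n + 1) ω))
    (q : H) (hq : IsProjPt (⋂ j, Z j) x0 q) :
    (∀ᵐ ω ∂μ, Tendsto (fun n => x n ω) atTop (𝓝 q)) ∧
    Tendsto (fun n => ∫ ω, ‖x n ω - q‖ ^ 2 ∂μ) atTop (𝓝 0) := by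
  -- deterministic facts
  have hqZ : ∀ j, q ∈ Z j := fun j => Set.mem_iInter.1 hq.1 j
  have hHp : ∀ n ω, q ∈ halfSpace (x n ω) (proj (ks n ω) (x n ω)) := fun n ω => by
    have := (hproj (ks n ω) (x n ω)).inner_le (hZconv _) q (hqZ _)
    rwa [real_inner_comm] at this
  have hO : ∀ n ω, q ∈ halfSpace x0 (x n ω) →
      IsProjPt (halfSpace x0 (x n ω) ∩ halfSpace (x n ω) (proj (ks n ω) (x n ω))) x0
        (x (n + 1) ω) := fun n ω h => by
    have h1 := hxsucc n ω
    rwa [Oset, if_pos ⟨q, h, hHp n ω⟩] at h1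
  have hHx : ∀ n ω, q ∈ halfSpace x0 (x n ω) := fun n ω => by
    induction n with
    | zero => simp [halfSpace, hxinit]
    | succ n ih =>
      have := (hO n ω ih).inner_le ((convex_halfSpace' _ _).inter (convex_halfSpace' _ _)) q
        ⟨ih, hHp n ω⟩
      rwa [real_inner_comm] at this
  have hO' := fun n ω => hO n ω (hHx n ω)
  have hmeas : ∀ n, Measurable (x n) := fun n => by
    induction n with
    | zero => rw [show x 0 = fun _ => x0 from funext hxinit]; exact measurable_const
    | succ n ih =>
      have hp1 : Measurable fun ω => proj (ks n ω) (x n ω) := by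
        have h2 : Measurable fun r : Fin p × H => proj r.1 r.2 :=
          measurable_from_prod_countable_right fun j =>
            (proj_lipschitz (hZconv j) (hproj j)).measurable
        exact h2.comp ((hksmeas n).prodMk ih)
      rw [show x (n + 1) = fun ω => haugQ x0 (x n ω) (proj (ks n ω) (x n ω)) from
        funext fun ω => haugQ_eq (hO' n ω)]
      exact measurable_haugQ x0 ih hp1
  have hbd : ∀ n ω, ‖x n ω - x0‖ ≤ ‖q - x0‖ := fun n ω => by
    cases n with
    | zero => simp [hxinit]
    | succ n =>
      rw [norm_sub_rev, norm_sub_rev q]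
      exact (hO' n ω).2 q ⟨hHx n ω, hHp n ω⟩
  have hstep : ∀ n ω, ‖x n ω - proj (ks n ω) (x n ω)‖ ^ 2 ≤
      ‖x (n + 1) ω - x0‖ ^ 2 - ‖x n ω - x0‖ ^ 2 := fun n ω => by
    obtain ⟨h1, h2⟩ := (hO' n ω).1
    simp only [halfSpace, Set.mem_ofPred_eq] at h1 h2
    set y := x n ω
    set z := proj (ks n ω) y
    set u := x (n + 1) ω
    have e1 : ‖u - x0‖ ^ 2 = ‖u - y‖ ^ 2 - 2 * ⟪u - y, x0 - y⟫ + ‖x0 - y‖ ^ 2 := by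
      rw [← norm_sub_sq_real]; congr 2; abel
    have e2 : ‖u - y‖ ^ 2 = ‖u - z‖ ^ 2 - 2 * ⟪u - z, y - z⟫ + ‖y - z‖ ^ 2 := by
      rw [← norm_sub_sq_real]; congr 2; abel
    rw [norm_sub_rev y x0]
    nlinarith [sq_nonneg ‖u - z‖]
  have hsum : ∀ N ω, ∑ n ∈ Finset.range N, ‖x n ω - proj (ks n ω) (x n ω)‖ ^ 2
      ≤ ‖q - x0‖ ^ 2 := fun N ω => by
    refine (Finset.sum_le_sum fun n _ => hstep n ω).trans ?_
    rw [Finset.sum_range_sub (fun n => ‖x n ω - x0‖ ^ 2)]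
    have : ‖x N ω - x0‖ ^ 2 ≤ ‖q - x0‖ ^ 2 := by gcongr; exact hbd N ω
    nlinarith [sq_nonneg ‖x 0 ω - x0‖]
  -- probabilistic part
  have hdist : ∀ j, ∀ᵐ ω ∂μ, Tendsto (fun n => ‖x n ω - proj j (x n ω)‖) atTop (𝓝 0) := by
    intro j
    let φ : H → ENNReal := fun v => ENNReal.ofReal (‖v - proj j v‖ ^ 2)
    have hφ : Measurable φ := by
      have := (proj_lipschitz (hZconv j) (hproj j)).measurable
      fun_prop
    let ι : Fin p → ENNReal := Set.indicator {j} 1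
    have hι : Measurable ι := measurable_of_finite _
    have hι' : ∀ n, ∫⁻ ω, ι (ks n ω) ∂μ = μ (k ⁻¹' {j}) := fun n => by
      rw [← hkscopy n j, ← lintegral_indicator_one (hksmeas n (measurableSet_singleton j))]
      rfl
    have hind : ∀ n, ∫⁻ ω, ι (ks n ω) * φ (x n ω) ∂μ
        = μ (k ⁻¹' {j}) * ∫⁻ ω, φ (x n ω) ∂μ := fun n => by
      rw [← hι' n]
      apply ProbabilityTheory.lintegral_mul_eq_lintegral_mul_lintegral_of_independent_measurableSpace
        (hksmeas n).comap_le _ (hksindep n)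
      · exact hι.comp (comap_measurable (ks n))
      · have h1 : MeasurableSpace.comap (x n) inferInstance ≤
            ⨆ i : Fin (n + 1), MeasurableSpace.comap (x i) inferInstance :=
          le_iSup (fun i : Fin (n + 1) => MeasurableSpace.comap (x i) inferInstance)
            (Fin.last n)
        exact (hφ.comp (comap_measurable (x n))).mono h1 le_rfl
      · exact iSup_le fun i => (hmeas i).comap_le
    have hs : ∀ ω, ∑' n, ι (ks n ω) * φ (x n ω) ≤ ENNReal.ofReal (‖q - x0‖ ^ 2) := fun ω => by
      refine ENNReal.tsum_le_of_sum_range_le fun N => ?_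
      refine le_trans ?_ (ENNReal.ofReal_le_ofReal (hsum N ω))
      rw [ENNReal.ofReal_sum_of_nonneg (fun _ _ => sq_nonneg _)]
      refine Finset.sum_le_sum fun n _ => ?_
      by_cases h : ks n ω = j
      · simp [ι, φ, h]
      · simp [ι, h]
    have hs2 : ∑' n, ∫⁻ ω, ι (ks n ω) * φ (x n ω) ∂μ ≤ ENNReal.ofReal (‖q - x0‖ ^ 2) := by
      rw [← lintegral_tsum (f := fun n ω => ι (ks n ω) * φ (x n ω)) fun n =>
        ((hι.comp (hksmeas n)).mul (hφ.comp (hmeas n))).aemeasurable]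
      refine (lintegral_mono hs).trans ?_
      simp
    have hs3 : ∑' n, ∫⁻ ω, φ (x n ω) ∂μ ≠ ⊤ := by
      simp_rw [hind] at hs2
      rw [ENNReal.tsum_mul_left] at hs2
      intro h
      rw [h, ENNReal.mul_top (hkpos j).ne'] at hs2
      simp at hs2
    rw [← lintegral_tsum (f := fun n ω => φ (x n ω)) fun n => (hφ.comp (hmeas n)).aemeasurable] at hs3
    have hs4 := ae_lt_top (Measurable.ennreal_tsum (f := fun n ω => φ (x n ω)) fun n => hφ.comp (hmeas n)) hs3
    filter_upwards [hs4] with ω hω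
    have h1 := ENNReal.tendsto_atTop_zero_of_tsum_ne_top hω.ne
    have h2 := (ENNReal.tendsto_toReal ENNReal.zero_ne_top).comp h1
    have h3 := h2.sqrt
    simpa [Function.comp_def, φ, ENNReal.toReal_ofReal, sq_nonneg] using h3
  have hae : ∀ᵐ ω ∂μ, Tendsto (fun n => x n ω) atTop (𝓝 q) := by
    filter_upwards [ae_all_iff.2 hdist] with ω hω
    exact det_conv hZconv hproj hq (fun n => x n ω) (fun n => hbd n ω) hω
  refine ⟨hae, ?_⟩
  have := tendsto_integral_of_dominated_convergence (μ := μ)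
    (F := fun n ω => ‖x n ω - q‖ ^ 2) (f := fun _ => (0 : ℝ))
    (fun _ => (2 * ‖q - x0‖) ^ 2)
    (fun n => (((hmeas n).sub_const q).norm.pow_const 2).aestronglyMeasurable)
    (integrable_const _)
    (fun n => Eventually.of_forall fun ω => by
      rw [Real.norm_of_nonneg (sq_nonneg _)]
      gcongr
      have h1 := norm_sub_le (x n ω - x0) (q - x0)
      rw [sub_sub_sub_cancel_right] at h1
      linarith [hbd n ω])
    (by
      filter_upwards [hae] with ω hω
      have h1 := (tendsto_iff_norm_sub_tendsto_zero.1 hω).pow 2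
      simpa using h1)
  simpa using this
end

section
/- Let H be a real Hilbert space, let x, a ∈ H, let λ ∈ (0,1], and set r = x + λ(a − x). Then the half-space H(x,a) admits the description H(x,a) = {z ∈ H : ⟪z − r, x − r⟫ ≤ −λ(1−λ)‖x − a‖²}, and consequently H(x,a) ⊆ H(x,r). -/
open RealInnerProductSpace

/-- Description of `H(x,a)` in terms of the relaxed point `r = x + λ(a - x)`, and the
inclusion `H(x,a) ⊆ H(x,r)`. -/
theorem halfSpace_relaxation {H : Type*} [NormedAddCommGroup H] [InnerProductSpace ℝ H]
    (x a : H) (lam : ℝ) (hlam : lam ∈ Set.Ioc (0 : ℝ) 1) (r : H)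
    (hr : r = x + lam • (a - x)) :
    halfSpace x a = {z : H | ⟪z - r, x - r⟫ ≤ -(lam * (1 - lam) * ‖x - a‖ ^ 2)} ∧
    halfSpace x a ⊆ halfSpace x r := by
  obtain ⟨h0, h1⟩ := hlam
  have key : ∀ z : H, ⟪z - r, x - r⟫ =
      lam * ⟪z - a, x - a⟫ - lam * (1 - lam) * ‖x - a‖ ^ 2 := by
    intro z
    have e1 : z - r = (z - a) - (1 - lam) • (x - a) := by rw [hr]; module
    have e2 : x - r = lam • (x - a) := by rw [hr]; module
    rw [e1, e2, inner_smul_right, inner_sub_left, real_inner_smul_left,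
      real_inner_self_eq_norm_sq]
    ring
  have h2 : 0 ≤ lam * (1 - lam) * ‖x - a‖ ^ 2 :=
    mul_nonneg (mul_nonneg h0.le (by linarith)) (sq_nonneg _)
  constructor
  · ext z
    simp only [halfSpace, Set.mem_setOf_eq, key]
    constructor
    · intro h
      have := mul_nonpos_of_nonneg_of_nonpos h0.le h
      linarith
    · intro h
      by_contra hc
      have := mul_pos h0 (not_le.mp hc)
      linarith
  · intro z hz
    simp only [halfSpace, Set.mem_setOf_eq, key] at hz ⊢
    have := mul_nonpos_of_nonneg_of_nonpos h0.le hz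
    linarith
end

section
/- Let H be a real Hilbert space, let M ≥ 1 be an integer, let T₁,…,T_M : H → H be firmly quasinonexpansive operators whose common fixed point set F = ∩_{i=1}^M Fix T_i is nonempty, let x ∈ H, and let β₁,…,β_M ∈ [0,1] with Σ_{i=1}^M β_i = 1. Set p_i = T_i x for each i, p = Σ_{i=1}^M β_i p_i, L = (Σ_{i=1}^M β_i ‖p_i − x‖²)/‖p − x‖² if p ≠ x and L = 1 if p = x, and a = x + L(p − x). Then L ≥ 1, and every z ∈ F satisfies ⟪z − a, x − a⟫ ≤ 0, i.e. F ⊆ H(x, a). -/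
open RealInnerProductSpace

/-- `T` is firmly quasinonexpansive. -/
def FirmlyQNE {H : Type*} [NormedAddCommGroup H] [InnerProductSpace ℝ H] (T : H → H) : Prop :=
  ∀ x y : H, T y = y → ‖T x - y‖ ^ 2 + ‖T x - x‖ ^ 2 ≤ ‖x - y‖ ^ 2

open scoped Classical in
theorem extrapolated_cut {H : Type*} [NormedAddCommGroup H] [InnerProductSpace ℝ H]
    (M : ℕ) (hM : 1 ≤ M) (T : Fin M → H → H) (hT : ∀ i, FirmlyQNE (T i))
    (F : Set H) (hF : F = ⋂ i, {y : H | T i y = y}) (hFne : F.Nonempty)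
    (x : H) (β : Fin M → ℝ) (hβ : ∀ i, β i ∈ Set.Icc (0 : ℝ) 1) (hsum : ∑ i, β i = 1)
    (p : Fin M → H) (hp : ∀ i, p i = T i x)
    (pbar : H) (hpbar : pbar = ∑ i, β i • p i)
    (L : ℝ)
    (hL : L = if pbar = x then 1 else (∑ i, β i * ‖p i - x‖ ^ 2) / ‖pbar - x‖ ^ 2)
    (a : H) (ha : a = x + L • (pbar - x)) :
    1 ≤ L ∧ F ⊆ halfSpace x a := by
  have hd : pbar - x = ∑ i, β i • (p i - x) := by
    simp only [smul_sub, Finset.sum_sub_distrib, ← Finset.sum_smul, hsum, one_smul, hpbar]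
  have hin : ∀ w : H, ⟪pbar - x, w⟫ = ∑ i, β i * ⟪p i - x, w⟫ := by
    intro w
    rw [hd, sum_inner]
    simp only [real_inner_smul_left]
  have h1 : ‖pbar - x‖ ^ 2 ≤ ∑ i, β i * ‖p i - x‖ ^ 2 := by
    have h0 : 0 ≤ ∑ i, β i * ‖(p i - x) - (pbar - x)‖ ^ 2 :=
      Finset.sum_nonneg fun i _ => mul_nonneg (hβ i).1 (sq_nonneg _)
    have he : ∑ i, β i * ‖(p i - x) - (pbar - x)‖ ^ 2
        = ∑ i, β i * ‖p i - x‖ ^ 2 - 2 * ∑ i, β i * ⟪p i - x, pbar - x⟫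
          + (∑ i, β i) * ‖pbar - x‖ ^ 2 := by
      rw [Finset.mul_sum, Finset.sum_mul, ← Finset.sum_sub_distrib, ← Finset.sum_add_distrib]
      refine Finset.sum_congr rfl fun i _ => ?_
      rw [norm_sub_sq_real (p i - x)]
      ring
    rw [he, ← hin, hsum, real_inner_self_eq_norm_sq] at h0
    linarith
  have hLS : pbar ≠ x → L * ‖pbar - x‖ ^ 2 = ∑ i, β i * ‖p i - x‖ ^ 2 := by
    intro h
    rw [hL, if_neg h]
    have : ‖pbar - x‖ ≠ 0 := norm_ne_zero_iff.2 (sub_ne_zero.2 h)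
    field_simp
  have hL1 : 1 ≤ L := by
    by_cases h : pbar = x
    · rw [hL, if_pos h]
    · rw [hL, if_neg h]
      have : 0 < ‖pbar - x‖ := norm_pos_iff.2 (sub_ne_zero.2 h)
      rw [le_div_iff₀ (by positivity)]
      linarith
  refine ⟨hL1, fun z hz => ?_⟩
  rw [hF, Set.mem_iInter] at hz
  change ⟪z - a, x - a⟫ ≤ 0
  by_cases h : pbar = x
  · simp [ha, h]
  have hS : ∑ i, β i * ‖p i - x‖ ^ 2 ≤ ⟪pbar - x, z - x⟫ := by
    rw [hin]
    refine Finset.sum_le_sum fun i _ => mul_le_mul_of_nonneg_left ?_ (hβ i).1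
    have h2 := hT i x z (hz i)
    rw [← hp i] at h2
    have e : p i - z = (p i - x) - (z - x) := by abel
    rw [e, norm_sub_sq_real, norm_sub_rev x z] at h2
    linarith
  have e1 : z - a = (z - x) - L • (pbar - x) := by rw [ha]; abel
  have e2 : x - a = -(L • (pbar - x)) := by rw [ha]; abel
  rw [e1, e2, inner_neg_right, inner_sub_left, real_inner_smul_right, real_inner_smul_left,
    real_inner_smul_right, real_inner_self_eq_norm_sq, real_inner_comm, hLS h]
  nlinarith [mul_nonneg (by linarith : (0:ℝ) ≤ L) (sub_nonneg.2 hS)]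
end

section
/- Let H be a real Hilbert space, let M ≥ 1 be an integer, let T₁,…,T_M : H → H be firmly quasinonexpansive operators, let z be a common fixed point of T₁,…,T_M, let x ∈ H, and let β₁,…,β_M ∈ [0,1] with Σ_{i=1}^M β_i = 1. Set p_i = T_i x for each i and p = Σ_{i=1}^M β_i p_i. Then 0 ≤ Σ_{i=1}^M β_i ⟪p_i − z, x − p_i⟫ ≤ ⟪p − z, x − p⟫. -/
open RealInnerProductSpace

theorem convex_combination_inner_ineq {H : Type*} [NormedAddCommGroup H] [InnerProductSpace ℝ H]
    (M : ℕ) (hM : 1 ≤ M) (T : Fin M → H → H) (hT : ∀ i, FirmlyQNE (T i))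
    (z : H) (hz : ∀ i, T i z = z) (x : H)
    (β : Fin M → ℝ) (hβ : ∀ i, β i ∈ Set.Icc (0 : ℝ) 1) (hsum : ∑ i, β i = 1)
    (p : Fin M → H) (hp : ∀ i, p i = T i x)
    (pbar : H) (hpbar : pbar = ∑ i, β i • p i) :
    0 ≤ ∑ i, β i * ⟪p i - z, x - p i⟫ ∧
    ∑ i, β i * ⟪p i - z, x - p i⟫ ≤ ⟪pbar - z, x - pbar⟫ := by
  constructor
  · refine Finset.sum_nonneg fun i _ => mul_nonneg (hβ i).1 ?_
    have h := hT i x z (hz i)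
    rw [← hp i] at h
    have e : x - z = (p i - z) + (x - p i) := by abel
    rw [e, norm_add_sq_real, norm_sub_rev (p i) x] at h
    linarith
  · have key : ∀ i, β i * ⟪p i - z, x - p i⟫ = β i * ⟪pbar - z, x - pbar⟫
        + ⟪β i • p i - β i • pbar, x + z - (2 : ℝ) • pbar⟫ - β i * ‖p i - pbar‖ ^ 2 := by
      intro i
      rw [← real_inner_self_eq_norm_sq]
      simp only [inner_sub_left, inner_sub_right, inner_add_right, inner_smul_left,
        inner_smul_right, conj_trivial]
      rw [real_inner_comm (p i) pbar, real_inner_comm z (p i), real_inner_comm z pbar]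
      ring
    have h0 : ∑ i, (β i • p i - β i • pbar) = 0 := by
      rw [Finset.sum_sub_distrib, ← Finset.sum_smul, hsum, ← hpbar, one_smul, sub_self]
    have hn : 0 ≤ ∑ i, β i * ‖p i - pbar‖ ^ 2 :=
      Finset.sum_nonneg fun i _ => mul_nonneg (hβ i).1 (sq_nonneg _)
    rw [Finset.sum_congr rfl fun i _ => key i, Finset.sum_sub_distrib, Finset.sum_add_distrib,
      ← Finset.sum_mul, hsum, ← sum_inner, h0, inner_zero_left]
    linarith
end
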